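/- Let S = B₃ be Stallings' group, the kernel of the homomorphism F₂ × F₂ × F₂ → ℤ sending each of the six free generators to 1. Then the second group cohomology of S with coefficients in the group ring ℤS (with the left-translation action of S) vanishes: H²(S, ℤS) = 0. -/

import Mathlib

/-- `F₂`, the free group on two generators. -/
abbrev F2 : Type := FreeGroup (Fin 2)

open Filter

section AlmostInvariant

variable {G X A : Type*} [Group G] [MulAction G X]

/-- The value of `β` at `t ^ n • x` is eventually equal to `p x`, for every point `x`. -/
def HasOrbitLimit (t : G) (β p : X → A) : Prop :=
  ∀ x, ∀ᶠ n : ℕ in atTop, β (t ^ n • x) = p x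

lemma eventually_smul (g : G) {P : X → Prop} (h : ∀ᶠ x in cofinite, P x) :
    ∀ᶠ x in cofinite, P (g • x) :=
  (MulAction.injective g).tendsto_cofinite.eventually h

lemma eventually_pow_smul {t : G} {x : X} (ht : Function.Injective fun n : ℤ => t ^ n • x)
    {P : X → Prop} (h : ∀ᶠ x in cofinite, P x) : ∀ᶠ n : ℕ in atTop, P (t ^ n • x) := by
  have hinj : Function.Injective fun n : ℕ => t ^ n • x := fun a b hab => by
    have := @ht a b (by simpa using hab)
    exact_mod_cast this
  rw [← Nat.cofinite_eq_atTop]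
  exact hinj.tendsto_cofinite.eventually h

lemma injective_inv_zpow_smul {t : G} {x : X} (ht : Function.Injective fun n : ℤ => t ^ n • x) :
    Function.Injective fun n : ℤ => t⁻¹ ^ n • x := fun a b hab => by
  have := @ht (-a) (-b) (by simpa using hab)
  simpa using this

lemma eventually_inv_smul_eq {t : G} {β : X → A} (h : ∀ᶠ x in cofinite, β (t • x) = β x) :
    ∀ᶠ x in cofinite, β (t⁻¹ • x) = β x := by
  filter_upwards [eventually_smul t⁻¹ h] with x hx
  simpa using hx.symm

lemma exists_hasOrbitLimit {t : G} (ht : ∀ x : X, Function.Injective fun n : ℤ => t ^ n • x)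
    {β : X → A} (h : ∀ᶠ x in cofinite, β (t • x) = β x) : ∃ p, HasOrbitLimit t β p := by
  have key : ∀ x, ∃ c, ∀ᶠ n : ℕ in atTop, β (t ^ n • x) = c := by
    intro x
    obtain ⟨M, hM⟩ := eventually_atTop.1 (eventually_pow_smul (ht x) h)
    refine ⟨β (t ^ M • x), eventually_atTop.2 ⟨M, fun n hn => ?_⟩⟩
    induction n, hn using Nat.le_induction with
    | base => rfl
    | succ n hn ih => rw [← ih, ← hM n hn, pow_succ', mul_smul]
  choose p hp using key
  exact ⟨p, hp⟩

lemma HasOrbitLimit.unique {t : G} {β p q : X → A} (hp : HasOrbitLimit t β p)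
    (hq : HasOrbitLimit t β q) : p = q := by
  funext x
  obtain ⟨n, h₁, h₂⟩ := ((hp x).and (hq x)).exists
  exact h₁.symm.trans h₂

lemma HasOrbitLimit.comp_smul {t g : G} {β p : X → A} (hp : HasOrbitLimit t β p)
    (hg : Commute t g) : HasOrbitLimit t (fun x => β (g • x)) (fun x => p (g • x)) := by
  intro x
  filter_upwards [hp (g • x)] with n hn
  rw [← hn, ← mul_smul, ← mul_smul, (hg.pow_left n).eq]

lemma HasOrbitLimit.smul_self {t : G} {β p : X → A} (hp : HasOrbitLimit t β p) (x : X) :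
    p (t • x) = p x := by
  obtain ⟨n, h₁, h₂⟩ := ((hp (t • x)).and ((tendsto_add_atTop_nat 1).eventually (hp x))).exists
  rw [← h₁, ← h₂, pow_succ, mul_smul]

lemma HasOrbitLimit.congr {t : G} (ht : ∀ x : X, Function.Injective fun n : ℤ => t ^ n • x)
    {β γ p : X → A} (hp : HasOrbitLimit t β p) (h : ∀ᶠ x in cofinite, β x = γ x) :
    HasOrbitLimit t γ p := by
  intro x
  filter_upwards [hp x, eventually_pow_smul (ht x) h] with n h₁ h₂
  rw [← h₂, h₁]

lemma pow_smul_eq_of_smul_eq {t : G} {p : X → A} (h : ∀ x, p (t • x) = p x) (n : ℕ) (x : X) :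
    p (t ^ n • x) = p x := by
  induction n with
  | zero => simp
  | succ n ih => rw [pow_succ', mul_smul, h, ih]

lemma zpow_smul_eq_of_smul_eq {t : G} {p : X → A} (h : ∀ x, p (t • x) = p x) (n : ℤ) (x : X) :
    p (t ^ n • x) = p x := by
  obtain ⟨n, rfl | rfl⟩ := n.eq_nat_or_neg
  · simpa using pow_smul_eq_of_smul_eq h n x
  · simpa using (pow_smul_eq_of_smul_eq h n (t⁻¹ ^ n • x)).symm

lemma zpow_smul_eq_of_forall {t : G} {β : X → A} {x : X}
    (h : ∀ n : ℤ, β (t • t ^ n • x) = β (t ^ n • x)) (n : ℤ) : β (t ^ n • x) = β x := by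
  have hsucc : ∀ n : ℤ, β (t ^ (n + 1) • x) = β (t ^ n • x) := fun n => by
    rw [add_comm, zpow_add, zpow_one, mul_smul, h]
  induction n with
  | zero => simp
  | succ n ih => rw [hsucc, ih]
  | pred n ih => rw [← ih, ← hsucc, sub_add_cancel]

lemma HasOrbitLimit.eq_of_forall {t : G} {β p : X → A} (hp : HasOrbitLimit t β p) {x : X}
    (h : ∀ n : ℤ, β (t ^ n • x) = β x) : p x = β x := by
  obtain ⟨n, hn⟩ := (hp x).exists
  rw [← hn]
  exact_mod_cast h n

lemma HasOrbitLimit.eq_of_forall_inv {t : G} {β p : X → A} (hp : HasOrbitLimit t⁻¹ β p) {x : X}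
    (h : ∀ n : ℤ, β (t ^ n • x) = β x) : p x = β x :=
  hp.eq_of_forall fun n => by rw [inv_zpow', h]

/-- Two invariant functions under an element with infinite orbits agree as soon as they agree
away from a finite set. -/
lemma eq_of_eventually_eq {t : G} (ht : ∀ x : X, Function.Injective fun n : ℤ => t ^ n • x)
    {p q : X → A} (hp : ∀ x, p (t • x) = p x) (hq : ∀ x, q (t • x) = q x)
    (h : ∀ᶠ x in cofinite, p x = q x) : p = q := by
  funext x
  obtain ⟨n, hn⟩ := (eventually_pow_smul (ht x) h).exists
  rwa [pow_smul_eq_of_smul_eq hp, pow_smul_eq_of_smul_eq hq] at hn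

/-- An almost invariant function with the invariant function `p` as its limit at both ends of
every orbit differs from `p` at finitely many points only. -/
lemma eventually_eq_of_hasOrbitLimit {t : G} {β p : X → A}
    (h : ∀ᶠ x in cofinite, β (t • x) = β x) (hpt : ∀ x, p (t • x) = p x)
    (hp : HasOrbitLimit t β p) (hp' : HasOrbitLimit t⁻¹ β p) :
    ∀ᶠ x in cofinite, β x = p x := by
  have hE : {x | ¬ β (t⁻¹ • x) = β x}.Finite := eventually_inv_smul_eq h
  choose K hK using fun x => eventually_atTop.1 (hp' x)
  refine (hE.biUnion fun e _ =>
    (Set.finite_lt_nat (K e)).image fun n => t⁻¹ ^ n • e).subset ?_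
  intro x hx
  obtain ⟨M, hM⟩ := (hp x).exists
  have hex : ∃ n, β (t ^ n • x) = p x := ⟨M, hM⟩
  classical
  obtain ⟨hn, hmin⟩ : β (t ^ Nat.find hex • x) = p x ∧
      ∀ m < Nat.find hex, ¬ β (t ^ m • x) = p x :=
    ⟨Nat.find_spec hex, fun m hm => Nat.find_min hex hm⟩
  generalize Nat.find hex = n at hn hmin
  obtain _ | n := n
  · exact absurd (by simpa using hn) hx
  have hback : t⁻¹ ^ (n + 1) • t ^ (n + 1) • x = x := by simp
  refine Set.mem_biUnion (x := t ^ (n + 1) • x) ?_ ⟨n + 1, ?_, hback⟩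
  · have : t⁻¹ • t ^ (n + 1) • x = t ^ n • x := by rw [pow_succ', mul_smul, inv_smul_smul]
    rw [Set.mem_ofPred_eq, this, hn]
    exact hmin n n.lt_succ_self
  · by_contra hlt
    have := hK (t ^ (n + 1) • x) (n + 1) (not_lt.1 hlt)
    rw [hback, pow_smul_eq_of_smul_eq hpt] at this
    exact hx this

/-- If `h` and `k` span a free abelian group of rank two that acts freely and all conjugates of
`h` commute with `k`, an almost invariant function is an invariant one up to finitely many
values. -/
theorem exists_invariant_eventually_eq {h k : G} (hk : ∀ g : G, Commute (g * h * g⁻¹) k)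
    (hfree : ∀ (a b : ℤ) (x : X), h ^ a • k ^ b • x = x → a = 0 ∧ b = 0) {β : X → A}
    (hβ : ∀ g : G, ∀ᶠ x in cofinite, β (g • x) = β x) :
    ∃ p : X → A, (∀ (g : G) x, p (g • x) = p x) ∧ ∀ᶠ x in cofinite, β x = p x := by
  have hhk : Commute h k := by simpa using hk 1
  have hh : ∀ x : X, Function.Injective fun n : ℤ => h ^ n • x := fun x a b hab => by
    have := (hfree (a - b) 0 x (by
      have : h ^ a • x = h ^ b • x := hab
      rw [zpow_zero, one_smul, sub_eq_neg_add, zpow_add, mul_smul, this, ← mul_smul, ← zpow_add]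
      simp)).1
    omega
  have hkk : ∀ x : X, Function.Injective fun n : ℤ => k ^ n • x := fun x a b hab => by
    have := (hfree 0 (a - b) x (by
      have : k ^ a • x = k ^ b • x := hab
      rw [zpow_zero, one_smul, sub_eq_neg_add, zpow_add, mul_smul, this, ← mul_smul, ← zpow_add]
      simp)).2
    omega
  obtain ⟨p, hp⟩ := exists_hasOrbitLimit hh (hβ h)
  obtain ⟨q, hq⟩ := exists_hasOrbitLimit (fun x => injective_inv_zpow_smul (hh x)) (hβ h⁻¹)
  have hph := hp.smul_self
  have hpk : ∀ x, p (k • x) = p x := fun x => congrFun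
    ((hp.comp_smul hhk).unique (hp.congr hh ((hβ k).mono fun _ hx => hx.symm))) x
  have hqk : ∀ x, q (k • x) = q x := fun x => congrFun
    ((hq.comp_smul hhk.inv_left).unique
      (hq.congr (fun x => injective_inv_zpow_smul (hh x)) ((hβ k).mono fun _ hx => hx.symm))) x
  have hE : {x | ¬ β (h • x) = β x}.Finite := hβ h
  have hpq : p = q := by
    funext x
    obtain ⟨n, hn⟩ : ∃ n : ℕ, ∀ m : ℤ, h ^ m • k ^ n • x ∉ {x | ¬ β (h • x) = β x} := by
      by_contra! hcon
      choose m hm using hcon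
      refine Set.infinite_of_injective_forall_mem (f := fun n : ℕ => h ^ m n • k ^ n • x)
        (fun a b hab => ?_) hm hE
      have := (hfree (m a - m b) (a - b) x (by
        have hab' : h ^ m a • k ^ a • x = h ^ m b • k ^ b • x := hab
        have hc : h ^ (-m b) * k ^ (-b : ℤ) = k ^ (-b : ℤ) * h ^ (-m b) :=
          hhk.zpow_zpow _ _
        have hc' : h ^ (m a) * k ^ (-b : ℤ) = k ^ (-b : ℤ) * h ^ (m a) :=
          hhk.zpow_zpow _ _
        have : h ^ (m a - m b) • k ^ (a - b : ℤ) • x =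
            k ^ (-b : ℤ) • h ^ (-m b) • h ^ m a • k ^ a • x := by
          rw [← zpow_natCast k a]
          simp only [← mul_smul]
          congr 1
          rw [sub_eq_neg_add, sub_eq_neg_add, zpow_add, zpow_add, mul_assoc,
            ← mul_assoc (h ^ m a), hc']
          simp only [← mul_assoc]
          rw [hc]
        rw [this, hab']
        simp)).2
      omega
    have hconst : ∀ m : ℤ, β (h • h ^ m • k ^ n • x) = β (h ^ m • k ^ n • x) :=
      fun m => not_not.1 (hn m)
    have hall := zpow_smul_eq_of_forall hconst
    rw [← pow_smul_eq_of_smul_eq hpk n x, ← pow_smul_eq_of_smul_eq hqk n x, hp.eq_of_forall hall,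
      hq.eq_of_forall_inv hall]
  have hβp : ∀ᶠ x in cofinite, β x = p x :=
    eventually_eq_of_hasOrbitLimit (hβ h) hph hp (hpq ▸ hq)
  refine ⟨p, fun g => ?_, hβp⟩
  have hgp : ∀ᶠ x in cofinite, p (g • x) = p x := by
    filter_upwards [hβp, eventually_smul g hβp, hβ g] with x h₁ h₂ h₃
    rw [← h₁, ← h₂, h₃]
  set h' := g⁻¹ * h * g with hh'
  have hh'k : Commute h' k := by simpa using hk g⁻¹
  have hconj : ∀ n : ℤ, h' ^ n = g⁻¹ * h ^ n * g := fun n => by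
    have := conj_zpow (i := n) (a := g⁻¹) (b := h)
    simpa using this
  have hh'inj : ∀ x : X, Function.Injective fun n : ℤ => h' ^ n • x := fun x a b hab => by
    refine hh (g • x) ?_
    simpa [hconj, mul_smul] using hab
  have hinv : ∀ x, p (g • h' • x) = p (g • x) := fun x => by
    rw [hh', mul_smul, mul_smul, smul_inv_smul, hph]
  have hgk : (fun x => p (g • k • x)) = fun x => p (g • x) := by
    refine eq_of_eventually_eq hh'inj (fun x => ?_) hinv ?_
    · rw [← mul_smul k, ← hh'k.eq, mul_smul, hinv]
    · filter_upwards [hgp, eventually_smul k hgp] with x h₁ h₂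
      rw [h₁, h₂, hpk]
  exact congrFun (eq_of_eventually_eq hkk (p := fun x => p (g • x)) (congrFun hgk) hpk hgp)

/-- Functions on a free `G`-set have no first cohomology. -/
theorem exists_eq_sub_of_free [AddCommGroup A] (hfree : ∀ (g : G) (x : X), g • x = x → g = 1)
    {P : G → X → A} (hP : ∀ g h x, P (g * h) x = P g x + P h (g⁻¹ • x)) :
    ∃ p : X → A, ∀ g x, P g x = p (g⁻¹ • x) - p x := by
  have hrep : ∀ x : X, ∃ g : G, g • x = (Quotient.mk (MulAction.orbitRel G X) x).out := fun x =>
    Quotient.exact (s := MulAction.orbitRel G X) (Quotient.out_eq _)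
  choose r hr using hrep
  have hrs : ∀ (g : G) (x : X), r (g⁻¹ • x) = r x * g := fun g x => by
    have hq : (Quotient.mk (MulAction.orbitRel G X) (g⁻¹ • x)) =
        Quotient.mk (MulAction.orbitRel G X) x := Quotient.sound ⟨g⁻¹, rfl⟩
    have h₁ := hr (g⁻¹ • x)
    rw [hq, ← hr x] at h₁
    have h₂ : ((r x)⁻¹ * r (g⁻¹ • x) * g⁻¹) • x = x := by
      rw [mul_smul, mul_smul, h₁, inv_smul_smul]
    have h₃ := hfree _ _ h₂
    rw [mul_inv_eq_one, inv_mul_eq_iff_eq_mul] at h₃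
    exact h₃
  refine ⟨fun x => P (r x) (r x • x), fun g x => ?_⟩
  have := hP (r x) g (r x • x)
  simp only [hrs, mul_smul, smul_inv_smul] at this ⊢
  rw [this, inv_smul_smul, add_sub_cancel_left]

end AlmostInvariant

lemma exists_int_antidifference {A : Type*} [AddCommGroup A] (a : ℤ → A) :
    ∃ F : ℤ → A, ∀ n, F (n + 1) - F n = a n := by
  refine ⟨fun n => match n with
    | .ofNat n => ∑ i ∈ Finset.range n, a i
    | .negSucc n => - ∑ i ∈ Finset.range (n + 1), a (-(i + 1)), fun n => ?_⟩
  match n with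
  | .ofNat n =>
    change ∑ i ∈ Finset.range (n + 1), a i - ∑ i ∈ Finset.range n, a i = a n
    rw [Finset.sum_range_succ, add_sub_cancel_left]
  | .negSucc 0 =>
    change ∑ i ∈ Finset.range 0, a i - - ∑ i ∈ Finset.range (0 + 1), a (-(i + 1)) = a (-1)
    simp
  | .negSucc (n + 1) =>
    change - ∑ i ∈ Finset.range (n + 1), a (-(i + 1)) -
      - ∑ i ∈ Finset.range (n + 1 + 1), a (-(i + 1)) = a (Int.negSucc (n + 1))
    rw [Finset.sum_range_succ _ (n + 1), Int.negSucc_eq]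
    simp

section AlmostDerivation

universe u v

variable {S : Type u} {A : Type v} [Group S] [AddCommGroup A]

/-- A map from `S` to the functions on `S` that is a derivation up to functions with finite
support. -/
def IsAlmostDerivation (φ : S → S → A) : Prop :=
  ∀ g h, ∀ᶠ x in cofinite, φ (g * h) x = φ g x + φ h (g⁻¹ * x)

lemma eventually_mul (g : S) {P : S → Prop} (h : ∀ᶠ x in cofinite, P x) :
    ∀ᶠ x in cofinite, P (g * x) :=
  eventually_smul g h

lemma IsAlmostDerivation.sub_inner {φ : S → S → A} (hφ : IsAlmostDerivation φ) (f : S → A) :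
    IsAlmostDerivation fun g x => φ g x - (f (g⁻¹ * x) - f x) := by
  intro g h
  filter_upwards [hφ g h] with x hx
  rw [hx, mul_inv_rev, mul_assoc]
  abel

/-- The values at elements commuting with `t` of an almost derivation that vanishes at `t` are
almost `t`-invariant. -/
lemma IsAlmostDerivation.eventually_mul_eq {φ : S → S → A} (hφ : IsAlmostDerivation φ) {t b : S}
    (ht : ∀ᶠ x in cofinite, φ t x = 0) (htb : Commute t b) :
    ∀ᶠ x in cofinite, φ b (t * x) = φ b x := by
  filter_upwards [eventually_mul t (hφ t b), eventually_mul t (hφ b t),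
    eventually_mul t ht, eventually_mul t (eventually_mul b⁻¹ ht)] with x h₁ h₂ h₃ h₄
  rw [inv_mul_cancel_left, h₃, zero_add] at h₁
  rw [h₄, add_zero, ← htb.eq] at h₂
  rw [← h₁, h₂]

/-- Coordinates on `S` adapted to left multiplication by the powers of an element `t` of infinite
order that commutes with a subgroup `N`. -/
lemma exists_orbit_coordinates (N : Subgroup S) {t : S} (htN : ∀ g ∈ N, Commute t g)
    (ht : ∀ n : ℤ, t ^ n = 1 → n = 0) :
    ∃ (X : Type u) (_ : MulAction N X) (π : S → X) (σ : X → S) (e : S → ℤ),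
      (∀ x, π (σ x) = x) ∧ (∀ (b : N) x, π (b * x) = b • π x) ∧
      (∀ x y, π x = π y ↔ ∃ n : ℤ, x = t ^ n * y) ∧ (∀ x, x = t ^ e x * σ (π x)) ∧
      ∀ (n : ℤ) x, e (t ^ n * x) = n + e x := by
  let s : Setoid S := MulAction.orbitRel (Subgroup.zpowers t) S
  have hs : ∀ x y : S, s x y ↔ ∃ n : ℤ, x = t ^ n * y := fun x y => by
    change x ∈ MulAction.orbit (Subgroup.zpowers t) y ↔ _
    constructor
    · rintro ⟨⟨_, n, rfl⟩, rfl⟩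
      exact ⟨n, rfl⟩
    · rintro ⟨n, rfl⟩
      exact ⟨⟨_, n, rfl⟩, rfl⟩
  let π : S → Quotient s := Quotient.mk s
  have hπ : ∀ x y, π x = π y ↔ ∃ n : ℤ, x = t ^ n * y := fun x y => Quotient.eq.trans (hs x y)
  let act : MulAction N (Quotient s) :=
    { smul b := Quotient.map (fun x => b * x) fun x y hxy => by
        obtain ⟨n, rfl⟩ := (hs x y).1 hxy
        refine (hs _ _).2 ⟨n, ?_⟩
        rw [← mul_assoc, ← mul_assoc, ((htN b b.2).zpow_left n).eq]
      one_smul := by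
        rintro ⟨x⟩
        exact congrArg π (one_mul x)
      mul_smul := by
        rintro b c ⟨x⟩
        exact congrArg π (mul_assoc (b : S) c x) }
  have he : ∀ x, ∃ n : ℤ, x = t ^ n * (π x).out := fun x =>
    (hπ _ _).1 (Quotient.out_eq (π x)).symm
  choose e he using he
  refine ⟨Quotient s, act, π, fun y => y.out, e, Quotient.out_eq, fun b x => rfl, hπ, he,
    fun n x => ?_⟩
  have h₁ := he (t ^ n * x)
  rw [(hπ (t ^ n * x) x).2 ⟨n, rfl⟩] at h₁
  generalize e (t ^ n * x) = m at h₁ ⊢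
  have h₂ := he x
  generalize (π x).out = y at h₁ h₂
  have h₃ : t ^ (n + e x) * y = t ^ m * y := by rw [zpow_add, mul_assoc, ← h₂, h₁]
  have h₄ := mul_right_cancel h₃
  have h₅ := ht (m - (n + e x)) (by rw [zpow_sub, ← h₄, mul_inv_cancel])
  omega

/-- An almost derivation is inner up to finite support on a subgroup `N` that is centralized by a
transverse element `t` of infinite order and contains a free abelian subgroup `⟨h, k⟩` of rank two
such that all `N`-conjugates of `h` commute with `k`. -/
lemma IsAlmostDerivation.exists_eventually_eq_of_mem {φ : S → S → A} (hφ : IsAlmostDerivation φ)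
    (N : Subgroup S) {h k t : S} (hhN : h ∈ N) (hkN : k ∈ N) (htN : ∀ g ∈ N, Commute t g)
    (hk : ∀ g ∈ N, Commute (g * h * g⁻¹) k)
    (hfree : ∀ a b : ℤ, h ^ a * k ^ b = 1 → a = 0 ∧ b = 0) (ht : ∀ n : ℤ, t ^ n ∈ N → n = 0) :
    ∃ f : S → A, ∀ b ∈ N, ∀ᶠ x in cofinite, φ b x = f (b⁻¹ * x) - f x := by
  have ht1 : ∀ n : ℤ, t ^ n = 1 → n = 0 := fun n hn => ht n (hn ▸ N.one_mem)
  obtain ⟨X, act, π, σ, e, hσ, hπb, hπ, he, hen⟩ := exists_orbit_coordinates N htN ht1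
  have hπt : ∀ x, π (t * x) = π x := fun x => (hπ _ _).2 ⟨1, by simp⟩
  have het : ∀ x, e (t * x) = 1 + e x := fun x => by simpa using hen 1 x
  have hinj : ∀ x : S, Function.Injective fun n : ℤ => t ^ n • x := fun x a b hab => by
    have hab' : t ^ a = t ^ b := mul_right_cancel hab
    have := ht1 (a - b) (by rw [zpow_sub, hab', mul_inv_cancel])
    omega
  -- Reduce to the case of an almost derivation vanishing at `t`.
  wlog hφt : ∀ x, φ t x = 0 generalizing φ
  · choose F hF using fun y : X => exists_int_antidifference fun n => - φ t (t ^ (n + 1) * σ y)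
    have := this (hφ.sub_inner fun x => F (π x) (e x)) fun x => by
      obtain ⟨y, rfl⟩ : ∃ y, t * y = x := ⟨t⁻¹ * x, by simp⟩
      have h₁ := hF (π y) (e y)
      rw [zpow_add, zpow_one, (Commute.refl t).zpow_left (e y) |>.eq, mul_assoc, ← he] at h₁
      rw [inv_mul_cancel_left, hπt, het, add_comm 1, ← neg_sub (F (π y) (e y + 1)), h₁, neg_neg,
        sub_self]
    obtain ⟨f, hf⟩ := this
    refine ⟨fun x => f x + F (π x) (e x), fun b hb => ?_⟩
    filter_upwards [hf b hb] with x hx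
    rw [sub_eq_iff_eq_add] at hx
    rw [hx]
    abel
  have hinv : ∀ b : N, ∀ᶠ x in cofinite, φ b (t • x) = φ b x := fun b =>
    hφ.eventually_mul_eq (.of_forall hφt) (htN b b.2)
  have hfreeX : ∀ (b : N) (x : X), b • x = x → b = 1 := fun b x hbx => by
    rw [← hσ x, ← hπb, hπ] at hbx
    obtain ⟨n, hn⟩ := hbx
    have hn' : (b : S) = t ^ n := mul_right_cancel hn
    have := ht n (hn' ▸ b.2)
    rw [this, zpow_zero] at hn'
    exact Subtype.ext hn'
  -- The limits along the orbits of `t` are derivations, hence inner.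
  have hlim : ∀ u : S, (∀ b ∈ N, Commute u b) →
      (∀ x : S, Function.Injective fun n : ℤ => u ^ n • x) →
      (∀ b : N, ∀ᶠ x in cofinite, φ b (u • x) = φ b x) → (∀ x, π (u * x) = π x) →
      (∀ p : S → A, (∀ x, p (u • x) = p x) → ∀ n : ℤ, ∀ x, p (t ^ n • x) = p x) →
      ∃ p : X → A, ∀ b : N, HasOrbitLimit u (φ b) fun x => p (b⁻¹ • π x) - p (π x) := by
    intro u huN huinj hinv hπu hut
    choose P hP using fun b : N => exists_hasOrbitLimit huinj (hinv b)
    have hPσ : ∀ b x, P b (σ (π x)) = P b x := fun b x => by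
      conv_rhs => rw [he x]
      exact (hut (P b) (hP b).smul_self _ _).symm
    have hcoc : ∀ b c x, P (b * c) x = P b x + P c ((b⁻¹ : S) • x) := by
      intro b c x
      refine congrFun ((hP (b * c)).unique (q := fun x => P b x + P c ((b⁻¹ : S) • x)) ?_) x
      have hc := (hP c).comp_smul (huN _ (N.inv_mem b.2))
      intro x
      filter_upwards [hP b x, hc x, eventually_pow_smul (huinj x) (hφ b c)] with n h₁ h₂ h₃
      rw [← h₁, ← h₂]
      exact h₃
    obtain ⟨p, hp⟩ := exists_eq_sub_of_free (P := fun b x => P b (σ x)) hfreeX (fun b c x => by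
      have : b⁻¹ • x = π ((b⁻¹ : S) • σ x) := by
        have := hπb b⁻¹ (σ x)
        rw [hσ] at this
        exact this.symm
      rw [hcoc, this, hPσ])
    refine ⟨p, fun b => ?_⟩
    have : P b = fun x => p (b⁻¹ • π x) - p (π x) := by
      funext x
      rw [← hPσ, hp]
    exact this ▸ hP b
  obtain ⟨p, hp⟩ := hlim t htN hinj hinv hπt fun p hp n x => zpow_smul_eq_of_smul_eq hp n x
  obtain ⟨q, hq⟩ := hlim t⁻¹ (fun b hb => (htN b hb).inv_left)
    (fun x => injective_inv_zpow_smul (hinj x)) (fun b => eventually_inv_smul_eq (hinv b))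
    (fun x => by rw [← hπt, mul_inv_cancel_left])
    fun p hp n x => zpow_smul_eq_of_smul_eq
      (fun x => by rw [← hp (t • x), inv_smul_smul]) n x
  -- Both primitives may be chosen to agree at all but finitely many orbits.
  have hpq : ∀ b : N, ∀ᶠ y in cofinite, p (b⁻¹ • y) - p y = q (b⁻¹ • y) - q y := by
    intro b
    refine Set.Finite.subset (Set.Finite.image π (hinv b)) ?_
    intro y hy
    by_contra hcon
    have hconst : ∀ n : ℤ, φ b (t • t ^ n • σ y) = φ b (t ^ n • σ y) := fun n => by
      by_contra hne
      exact hcon ⟨_, hne, by rw [← hσ y, hπ]; exact ⟨n, by rw [hσ]; rfl⟩⟩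
    have hall := zpow_smul_eq_of_forall hconst
    have hpq := ((hp b).eq_of_forall hall).trans ((hq b).eq_of_forall_inv hall).symm
    rw [hσ] at hpq
    exact hy hpq
  obtain ⟨m, hm, hmpq⟩ := exists_invariant_eventually_eq (G := N) (X := X)
    (h := ⟨h, hhN⟩) (k := ⟨k, hkN⟩) (β := fun y => p y - q y)
    (fun g => Subtype.ext (hk g g.2).eq)
    (fun a b x hx => hfree a b (by
      rw [← mul_smul] at hx
      exact congrArg Subtype.val (hfreeX _ x hx)))
    (fun b => by
      filter_upwards [hpq b⁻¹] with y hy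
      rw [inv_inv] at hy
      rw [sub_eq_sub_iff_sub_eq_sub, hy])
  obtain ⟨p', hp', hp'q⟩ : ∃ p' : X → A,
      (∀ b : N, HasOrbitLimit t (φ b) fun x => p' (b⁻¹ • π x) - p' (π x)) ∧
        ∀ᶠ y in cofinite, p' y = q y := by
    refine ⟨fun y => p y - m y, fun b => ?_, ?_⟩
    · simpa only [hm, sub_sub_sub_cancel_right] using hp b
    · filter_upwards [hmpq] with y hy
      rw [← hy, sub_sub_cancel]
  let f : S → A := fun x => if 0 ≤ e x then p' (π x) else q (π x)
  have hfp : HasOrbitLimit t f fun x => p' (π x) := fun x => by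
    filter_upwards [eventually_ge_atTop (e x).natAbs] with n hn
    have h₁ : π (t ^ n • x) = π x := (hπ _ _).2 ⟨n, by simp⟩
    have h₂ : e (t ^ n • x) = n + e x := by simpa using hen n x
    rw [← h₁]
    exact if_pos (by omega)
  have hfq : HasOrbitLimit t⁻¹ f fun x => q (π x) := fun x => by
    filter_upwards [eventually_gt_atTop (e x).natAbs] with n hn
    have h₁ : π (t⁻¹ ^ n • x) = π x := (hπ _ _).2 ⟨-n, by simp⟩
    have h₂ : e (t⁻¹ ^ n • x) = -n + e x := by simpa using hen (-n) x
    rw [← h₁]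
    exact if_neg (by omega)
  have hft : ∀ᶠ x in cofinite, f (t • x) = f x := by
    refine Set.Finite.subset (Set.Finite.image (fun y => t⁻¹ * σ y) hp'q) fun x hx => ?_
    have hx' : ¬ (if 0 ≤ e (t * x) then p' (π (t * x)) else q (π (t * x))) =
      if 0 ≤ e x then p' (π x) else q (π x) := hx
    rw [hπt, het] at hx'
    have hex : e x = -1 := by
      by_contra hne
      refine hx' ?_
      congr 1
      exact propext ⟨fun _ => by omega, fun _ => by omega⟩
    refine ⟨π x, fun heq : p' (π x) = q (π x) => hx' (by simp [heq]), ?_⟩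
    have := he x
    rw [hex, zpow_neg_one] at this
    exact this.symm
  have hft' : ∀ b : N, ∀ᶠ x in cofinite, f ((b⁻¹ : S) * (t * x)) = f ((b⁻¹ : S) * x) := fun b => by
    filter_upwards [eventually_mul (b⁻¹ : S) hft] with x hx
    rw [← mul_assoc, ← (htN _ (N.inv_mem b.2)).eq, mul_assoc]
    exact hx
  have hπinv : ∀ (b : N) x, π ((b⁻¹ : S) * x) = b⁻¹ • π x := fun b x => hπb b⁻¹ x
  refine ⟨f, fun b hb => ?_⟩
  have := eventually_eq_of_hasOrbitLimit (t := t) (p := fun _ => 0)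
    (β := fun x => φ b x - (f (b⁻¹ * x) - f x)) ?_ (fun _ => rfl) ?_ ?_
  · filter_upwards [this] with x hx
    rwa [sub_eq_zero] at hx
  · filter_upwards [hinv ⟨b, hb⟩, hft, hft' ⟨b, hb⟩] with x h₁ h₂ h₃
    simp only [smul_eq_mul] at h₁ h₂ ⊢
    rw [h₁, h₂, h₃]
  · intro x
    filter_upwards [hp' ⟨b, hb⟩ x, hfp x, hfp.comp_smul (htN _ (N.inv_mem hb)) x] with n h₁ h₂ h₃
    simp only [smul_eq_mul] at h₁ h₂ h₃ ⊢
    rw [h₁, h₂, h₃, hπinv ⟨b, hb⟩, sub_self]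
  · intro x
    filter_upwards [hq ⟨b, hb⟩ x, hfq x,
      hfq.comp_smul (htN _ (N.inv_mem hb)).inv_left x] with n h₁ h₂ h₃
    simp only [smul_eq_mul] at h₁ h₂ h₃ ⊢
    rw [h₁, h₂, h₃, hπinv ⟨b, hb⟩, sub_self]

/-- If a normal subgroup `N` is centralized by a transverse element `t` of infinite order and
contains a free abelian subgroup `⟨h, k⟩` of rank two such that all `N`-conjugates of `h` commute
with `k`, then every almost derivation is inner up to finite support. -/
theorem IsAlmostDerivation.exists_eventually_eq {φ : S → S → A} (hφ : IsAlmostDerivation φ)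
    (N : Subgroup S) [N.Normal] {h k t : S} (hhN : h ∈ N) (hkN : k ∈ N)
    (htN : ∀ g ∈ N, Commute t g) (hk : ∀ g ∈ N, Commute (g * h * g⁻¹) k)
    (hfree : ∀ a b : ℤ, h ^ a * k ^ b = 1 → a = 0 ∧ b = 0) (ht : ∀ n : ℤ, t ^ n ∈ N → n = 0) :
    ∃ f : S → A, ∀ g, ∀ᶠ x in cofinite, φ g x = f (g⁻¹ * x) - f x := by
  wlog hφN : ∀ b ∈ N, ∀ᶠ x in cofinite, φ b x = 0 generalizing φ
  · obtain ⟨f, hf⟩ := hφ.exists_eventually_eq_of_mem N hhN hkN htN hk hfree ht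
    obtain ⟨f', hf'⟩ := this (hφ.sub_inner f) fun b hb => by
      filter_upwards [hf b hb] with x hx
      rw [hx, sub_self]
    refine ⟨fun x => f' x + f x, fun g => ?_⟩
    filter_upwards [hf' g] with x hx
    rw [sub_eq_iff_eq_add] at hx
    rw [hx]
    abel
  have hinj : ∀ x : S, Function.Injective fun n : ℤ => h ^ n • x := fun x a b hab => by
    have hab' : h ^ a = h ^ b := mul_right_cancel hab
    have := (hfree (a - b) 0 (by rw [zpow_sub, hab', mul_inv_cancel, zpow_zero, one_mul])).1
    omega
  have hψ : ∀ g : S, ∃ p : S → A, (∀ b ∈ N, ∀ x, p (b * x) = p x) ∧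
      ∀ᶠ x in cofinite, φ g x = p x := by
    intro g
    obtain ⟨p, hp, hgp⟩ := exists_invariant_eventually_eq (G := N) (X := S)
      (h := ⟨h, hhN⟩) (k := ⟨k, hkN⟩) (β := φ g)
      (fun g => Subtype.ext (hk g g.2).eq)
      (fun a b x hx => hfree a b (by
        rw [← mul_smul] at hx
        exact mul_eq_right.1 hx))
      (fun b => by
        have hb' : g⁻¹ * b * g ∈ N := by
          simpa using ‹N.Normal›.conj_mem b b.2 g⁻¹
        have hbg : (b : S) * g = g * (g⁻¹ * b * g) := by group
        filter_upwards [eventually_mul (b : S) (hφ b g), eventually_mul (b : S) (hφN b b.2),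
          eventually_mul (b : S) (hφ g (g⁻¹ * b * g)),
          eventually_mul (b : S) (eventually_mul g⁻¹ (hφN _ hb'))] with x h₁ h₂ h₃ h₄
        rw [h₂, zero_add, inv_mul_cancel_left] at h₁
        rw [h₄, add_zero, ← hbg, h₁] at h₃
        exact h₃.symm)
    exact ⟨p, fun b hb x => hp ⟨b, hb⟩ x, hgp⟩
  choose ψ hψN hψ using hψ
  have hcoc : ∀ g g' x, ψ (g * g') x = ψ g x + ψ g' (g⁻¹ * x) := by
    intro g g'
    refine congrFun (eq_of_eventually_eq (t := h) (q := fun x => ψ g x + ψ g' (g⁻¹ * x)) hinj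
      (fun x => hψN _ h hhN x) (fun x => ?_) ?_)
    · have hh' : g⁻¹ * h * g ∈ N := by simpa using ‹N.Normal›.conj_mem h hhN g⁻¹
      have : g⁻¹ * (h * x) = (g⁻¹ * h * g) * (g⁻¹ * x) := by group
      rw [smul_eq_mul, hψN g h hhN, this, hψN g' _ hh']
    · filter_upwards [hφ g g', hψ (g * g'), hψ g, eventually_mul g⁻¹ (hψ g')] with x h₁ h₂ h₃ h₄
      rw [← h₂, h₁, h₃, h₄]
  obtain ⟨f, hf⟩ := exists_eq_sub_of_free (G := S) (X := S) (P := ψ)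
    (fun g x hgx => mul_eq_right.1 hgx) hcoc
  refine ⟨f, fun g => ?_⟩
  filter_upwards [hψ g] with x hx
  rw [hx, hf]
  rfl

open groupCohomology in
/-- If a normal subgroup `N` is centralized by a transverse element `t` of infinite order and
contains a free abelian subgroup `⟨h, k⟩` of rank two such that all `N`-conjugates of `h` commute
with `k`, then the second cohomology of the group with coefficients in its group ring vanishes. -/
theorem subsingleton_H2_ofMulAction {R S : Type u} [CommRing R] [Group S]
    (N : Subgroup S) [N.Normal] {h k t : S} (hhN : h ∈ N) (hkN : k ∈ N)
    (htN : ∀ g ∈ N, Commute t g) (hk : ∀ g ∈ N, Commute (g * h * g⁻¹) k)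
    (hfree : ∀ a b : ℤ, h ^ a * k ^ b = 1 → a = 0 ∧ b = 0) (ht : ∀ n : ℤ, t ^ n ∈ N → n = 0) :
    Subsingleton (groupCohomology (Rep.ofMulAction R S S) 2) := by
  refine subsingleton_of_forall_eq 0 fun z => ?_
  induction z using H2_induction_on with | _ c
  rw [H2π_eq_zero_iff]
  have hc : ∀ (g h j x : S), (c (g * h, j)).coeff x + (c (g, h)).coeff x =
      (c (h, j)).coeff (g⁻¹ * x) + (c (g, h * j)).coeff x := fun g h j x => by
    have := congrArg (fun a : MonoidAlgebra R S => a.coeff x) ((mem_cocycles₂_iff c.1).1 c.2 g h j)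
    simpa using this
  let φ : S → S → R := fun g x => (c (x⁻¹, g)).coeff 1
  have hφ : ∀ g g' x, φ (g * g') x + (c (g, g')).coeff x = φ g x + φ g' (g⁻¹ * x) := by
    intro g g' x
    have := hc x⁻¹ g g' 1
    rw [inv_inv, mul_one] at this
    simp only [φ, mul_inv_rev, inv_inv]
    rw [add_comm, ← this, add_comm]
  have hder : IsAlmostDerivation φ := fun g g' => by
    refine Set.Finite.subset (c (g, g')).coeff.hasFiniteSupport fun x hx hcx => hx ?_
    change φ (g * g') x = φ g x + φ g' (g⁻¹ * x)
    rw [← hφ, hcx, add_zero]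
  obtain ⟨f, hf⟩ := hder.exists_eventually_eq N hhN hkN htN hk hfree ht
  have hfin : ∀ g, {x | φ g x - (f (g⁻¹ * x) - f x) ≠ 0}.Finite := fun g => by
    refine Set.Finite.subset (hf g) fun x hx hfx => hx ?_
    rw [hfx, sub_self]
  let y : S → MonoidAlgebra R S := fun g =>
    .ofCoeff (Finsupp.ofSupportFinite (fun x => φ g x - (f (g⁻¹ * x) - f x)) (hfin g))
  have hy : ∀ g x, (y g).coeff x = φ g x - (f (g⁻¹ * x) - f x) := fun g x => rfl
  refine ⟨y, funext fun ⟨g, g'⟩ => MonoidAlgebra.ext (Finsupp.ext fun x => ?_)⟩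
  change (Representation.ofMulAction R S S g (y g') - y (g * g') + y g).coeff x =
    (c (g, g')).coeff x
  rw [MonoidAlgebra.coeff_add, MonoidAlgebra.coeff_sub, Finsupp.add_apply, Finsupp.sub_apply,
    Representation.coeff_ofMulAction, smul_eq_mul, hy, hy, hy, mul_inv_rev, mul_assoc,
    eq_sub_of_add_eq (hφ g g' x)]
  abel

end AlmostDerivation

/-- For `S = B₃` Stallings' group, the kernel of the homomorphism `F₂ × F₂ × F₂ → ℤ`
sending each of the six free generators to `1`, the second group cohomology of `S` with
coefficients in the group ring `ℤS` (with the left-translation action) vanishes: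
`H²(S, ℤS) = 0`. -/
theorem stmt_16 (ψ : F2 × F2 × F2 →* Multiplicative ℤ)
    (h₁ : ∀ i : Fin 2, ψ (FreeGroup.of i, 1, 1) = Multiplicative.ofAdd 1)
    (h₂ : ∀ i : Fin 2, ψ (1, FreeGroup.of i, 1) = Multiplicative.ofAdd 1)
    (h₃ : ∀ i : Fin 2, ψ (1, 1, FreeGroup.of i) = Multiplicative.ofAdd 1) :
    Subsingleton (groupCohomology (Rep.ofMulAction ℤ ψ.ker ψ.ker) 2) := by
  let w : F2 := FreeGroup.of 0 * (FreeGroup.of 1)⁻¹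
  have hw : w ≠ 1 := fun h => by
    have := FreeGroup.of_injective (mul_inv_eq_one.1 h)
    simp at this
  have hk₁ : ((w, 1, 1) : F2 × F2 × F2) ∈ ψ.ker := by
    have : ((w, 1, 1) : F2 × F2 × F2) = (.of 0, 1, 1) * (.of 1, 1, 1)⁻¹ := by simp [w]
    rw [MonoidHom.mem_ker, this, map_mul, map_inv, h₁, h₁, mul_inv_cancel]
  have hk₂ : ((1, w, 1) : F2 × F2 × F2) ∈ ψ.ker := by
    have : ((1, w, 1) : F2 × F2 × F2) = (1, .of 0, 1) * (1, .of 1, 1)⁻¹ := by simp [w]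
    rw [MonoidHom.mem_ker, this, map_mul, map_inv, h₂, h₂, mul_inv_cancel]
  have hk₃ : ((1, 1, w) : F2 × F2 × F2) ∈ ψ.ker := by
    have : ((1, 1, w) : F2 × F2 × F2) = (1, 1, .of 0) * (1, 1, .of 1)⁻¹ := by simp [w]
    rw [MonoidHom.mem_ker, this, map_mul, map_inv, h₃, h₃, mul_inv_cancel]
  let π₃ : ψ.ker →* F2 :=
    ((MonoidHom.snd F2 F2).comp (MonoidHom.snd F2 (F2 × F2))).comp ψ.ker.subtype
  have hN : ∀ g : ψ.ker, g ∈ π₃.ker ↔ g.1.2.2 = 1 := fun g => Iff.rfl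
  refine subsingleton_H2_ofMulAction π₃.ker (h := ⟨_, hk₁⟩) (k := ⟨_, hk₂⟩) (t := ⟨_, hk₃⟩)
    rfl rfl (fun g hg => ?_) (fun g _ => ?_) (fun a b hab => ?_) (fun n hn => ?_)
  · have := (hN g).1 hg
    refine Subtype.ext ?_
    ext <;> simp [this]
  · refine Subtype.ext ?_
    ext <;> simp
  · simpa [Prod.ext_iff, hw] using congrArg Subtype.val hab
  · simpa [hw] using (hN _).1 hn
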